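/- arXiv:1912.00983 — 3 statements merged into one kernel-verified Lean document; each statement's English description precedes it below -/
import Mathlib

section
/- Let N be a unital *-subalgebra of the d×d complex matrices, and let E be the orthogonal projection of the space of d×d complex matrices onto N with respect to the Hilbert–Schmidt (Frobenius) inner product ⟨X,Y⟩ = tr(XᴴY). Then for every positive definite density ρ and every positive definite density ω: D(ρ‖E(ρ)) + D(ρ‖ω) ≥ D(ρ‖E(ω)). -/
open Matrix
open scoped ComplexOrder

/-- Matrix logarithm of a Hermitian matrix via functional calculus
(junk value `0` for non-Hermitian input). -/
noncomputable def matLog {d : ℕ} (A : Matrix (Fin d) (Fin d) ℂ) : Matrix (Fin d) (Fin d) ℂ :=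
  if hA : A.IsHermitian then hA.cfc Real.log else 0

/-- Umegaki relative entropy `D(ρ‖σ) = Re tr (ρ (log ρ - log σ))`. -/
noncomputable def relEnt {d : ℕ} (ρ σ : Matrix (Fin d) (Fin d) ℂ) : ℝ :=
  ((ρ * (matLog ρ - matLog σ)).trace).re

/-- A density matrix: positive semidefinite with trace one. -/
def IsDensity {d : ℕ} (ρ : Matrix (Fin d) (Fin d) ℂ) : Prop :=
  ρ.PosSemidef ∧ ρ.trace = 1

/-- `ρ` majorizes `σ`: for every `k`, the maximum over `k`-element index sets of the
sum of corresponding eigenvalues of `ρ` dominates the analogous maximum for `σ`. -/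
def Majorizes {d : ℕ} {ρ σ : Matrix (Fin d) (Fin d) ℂ}
    (hρ : ρ.IsHermitian) (hσ : σ.IsHermitian) : Prop :=
  ∀ k : ℕ, k ≤ d → ∀ T : Finset (Fin d), T.card = k →
    ∃ S : Finset (Fin d), S.card = k ∧ ∑ i ∈ T, hσ.eigenvalues i ≤ ∑ i ∈ S, hρ.eigenvalues i

namespace Matrix.IsHermitian

variable {n : Type*} [Fintype n] [DecidableEq n] {A B : Matrix n n ℂ}

/-- The matrix of `X` with respect to the eigenbases of `A` (rows) and `B` (columns). -/
noncomputable def eigenCoord (hA : A.IsHermitian) (hB : B.IsHermitian) (X : Matrix n n ℂ) :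
    Matrix n n ℂ :=
  star (hA.eigenvectorUnitary : Matrix n n ℂ) * X * (hB.eigenvectorUnitary : Matrix n n ℂ)

lemma cfc_eq_mul (hA : A.IsHermitian) (f : ℝ → ℝ) :
    hA.cfc f = (hA.eigenvectorUnitary : Matrix n n ℂ) *
      diagonal (fun i ↦ (f (hA.eigenvalues i) : ℂ)) *
      star (hA.eigenvectorUnitary : Matrix n n ℂ) := by
  rw [IsHermitian.cfc, Unitary.conjStarAlgAut_apply]
  rfl

lemma star_mul_eigenvectorUnitary (hA : A.IsHermitian) :
    star (hA.eigenvectorUnitary : Matrix n n ℂ) * hA.eigenvectorUnitary = 1 :=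
  Unitary.coe_star_mul_self _

lemma eigenvectorUnitary_mul_star (hA : A.IsHermitian) :
    (hA.eigenvectorUnitary : Matrix n n ℂ) * star (hA.eigenvectorUnitary : Matrix n n ℂ) = 1 :=
  Unitary.coe_mul_star_self _

lemma cfc_id_eq (hA : A.IsHermitian) : hA.cfc id = A := hA.spectral_theorem.symm

lemma cfc_one_eq (hA : A.IsHermitian) : hA.cfc 1 = 1 := by
  rw [cfc_eq_mul]
  simp

lemma cfc_mul_cfc (hA : A.IsHermitian) (f g : ℝ → ℝ) :
    hA.cfc f * hA.cfc g = hA.cfc (f * g) := by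
  rw [IsHermitian.cfc, IsHermitian.cfc, IsHermitian.cfc, ← map_mul, diagonal_mul_diagonal]
  simp [Function.comp_def]

lemma conjTranspose_cfc (hA : A.IsHermitian) (f : ℝ → ℝ) : (hA.cfc f)ᴴ = hA.cfc f := by
  rw [cfc_eq_mul]
  simp [Matrix.star_eq_conjTranspose, Matrix.mul_assoc, Pi.star_def]

lemma eigenCoord_add (hA : A.IsHermitian) (hB : B.IsHermitian) (X Y : Matrix n n ℂ) :
    hA.eigenCoord hB (X + Y) = hA.eigenCoord hB X + hA.eigenCoord hB Y := by
  simp [eigenCoord, mul_add, add_mul]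

lemma eigenCoord_smul (hA : A.IsHermitian) (hB : B.IsHermitian) (c : ℂ) (X : Matrix n n ℂ) :
    hA.eigenCoord hB (c • X) = c • hA.eigenCoord hB X := by
  simp [eigenCoord]

lemma eigenCoord_cfc_mul (hA : A.IsHermitian) (hB : B.IsHermitian) (f : ℝ → ℝ)
    (X : Matrix n n ℂ) (i j : n) :
    hA.eigenCoord hB (hA.cfc f * X) i j = f (hA.eigenvalues i) * hA.eigenCoord hB X i j := by
  rw [← diagonal_mul (fun i ↦ (f (hA.eigenvalues i) : ℂ))]
  simp only [eigenCoord, cfc_eq_mul, ← mul_assoc, star_mul_eigenvectorUnitary, one_mul]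

lemma eigenCoord_mul_cfc (hA : A.IsHermitian) (hB : B.IsHermitian) (f : ℝ → ℝ)
    (X : Matrix n n ℂ) (i j : n) :
    hA.eigenCoord hB (X * hB.cfc f) i j = hA.eigenCoord hB X i j * f (hB.eigenvalues j) := by
  rw [← mul_diagonal (fun j ↦ (f (hB.eigenvalues j) : ℂ))]
  simp only [eigenCoord, cfc_eq_mul, mul_assoc, star_mul_eigenvectorUnitary, mul_one]

lemma eigenCoord_injective (hA : A.IsHermitian) (hB : B.IsHermitian) :
    Function.Injective (hA.eigenCoord hB) := by
  intro X Y h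
  have key (Z : Matrix n n ℂ) : Z = (hA.eigenvectorUnitary : Matrix n n ℂ) *
      hA.eigenCoord hB Z * star (hB.eigenvectorUnitary : Matrix n n ℂ) := by
    simp only [eigenCoord, mul_assoc, eigenvectorUnitary_mul_star, mul_one]
    rw [← mul_assoc, eigenvectorUnitary_mul_star, one_mul]
  rw [key X, key Y, h]

lemma trace_conjTranspose_mul_eq_sum (hA : A.IsHermitian) (hB : B.IsHermitian)
    (X Y : Matrix n n ℂ) :
    (Xᴴ * Y).trace = ∑ i, ∑ j, star (hA.eigenCoord hB X i j) * hA.eigenCoord hB Y i j := by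
  have h : ((hA.eigenCoord hB X)ᴴ * hA.eigenCoord hB Y).trace = (Xᴴ * Y).trace := by
    have : (hA.eigenCoord hB X)ᴴ * hA.eigenCoord hB Y =
        star (hB.eigenvectorUnitary : Matrix n n ℂ) * (Xᴴ * Y) * hB.eigenvectorUnitary := by
      simp only [eigenCoord, ← star_eq_conjTranspose, star_mul, star_star]
      simp only [mul_assoc]
      rw [← mul_assoc (hA.eigenvectorUnitary : Matrix n n ℂ), eigenvectorUnitary_mul_star, one_mul]
    rw [this, trace_mul_cycle, eigenvectorUnitary_mul_star, one_mul]
  rw [← h, Finset.sum_comm]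
  simp [trace, mul_apply]

lemma trace_cfc_mul_cfc (hA : A.IsHermitian) (hB : B.IsHermitian) (f g : ℝ → ℝ) :
    (hB.cfc f * hA.cfc g).trace.re = ∑ i, ∑ j,
      ‖hA.eigenCoord hB 1 i j‖ ^ 2 * (f (hB.eigenvalues j) * g (hA.eigenvalues i)) := by
  have h := hA.trace_conjTranspose_mul_eq_sum hB (hA.cfc g) (hB.cfc f)
  rw [conjTranspose_cfc, trace_mul_comm] at h
  rw [h, Complex.re_sum]
  refine Finset.sum_congr rfl fun i _ ↦ ?_
  rw [Complex.re_sum]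
  refine Finset.sum_congr rfl fun j _ ↦ ?_
  have h1 := hA.eigenCoord_cfc_mul hB g 1 i j
  have h2 := hA.eigenCoord_mul_cfc hB f 1 i j
  rw [mul_one] at h1
  rw [one_mul] at h2
  rw [h1, h2, ← Complex.normSq_eq_norm_sq, Complex.normSq_apply]
  simp
  ring

lemma cfc_mem (hA : A.IsHermitian) {N : StarSubalgebra ℂ (Matrix n n ℂ)} (hAN : A ∈ N)
    (f : ℝ → ℝ) : hA.cfc f ∈ N := by
  classical
  let s : Finset ℂ := Finset.univ.image fun i ↦ (hA.eigenvalues i : ℂ)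
  let P := Lagrange.interpolate s id fun z ↦ (f z.re : ℂ)
  have hP (i : n) : P.eval (hA.eigenvalues i : ℂ) = f (hA.eigenvalues i) := by
    have := Lagrange.eval_interpolate_at_node (s := s) (v := id) (fun z : ℂ ↦ (f z.re : ℂ))
      (Set.injOn_id _) (i := (hA.eigenvalues i : ℂ)) (by simp [s])
    exact this
  have key : Polynomial.aeval A P = hA.cfc f := by
    conv_lhs => rw [hA.spectral_theorem]
    rw [IsHermitian.cfc, Polynomial.aeval_algHom_apply]
    congr 1
    have h := Polynomial.aeval_algHom_apply (diagonalAlgHom ℂ (n := n) (α := ℂ))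
      (RCLike.ofReal ∘ hA.eigenvalues) P
    simp only [diagonalAlgHom_apply] at h
    rw [h]
    congr 1
    ext i
    simp [← hP]
  rw [← key]
  exact Algebra.adjoin_le (S := N.toSubalgebra) (by simpa using hAN)
    (Polynomial.aeval_mem_adjoin_singleton ℂ A)

lemma eigenCoord_mul_left (hA : A.IsHermitian) (hB : B.IsHermitian) (X : Matrix n n ℂ) (i j : n) :
    hA.eigenCoord hB (A * X) i j = hA.eigenvalues i * hA.eigenCoord hB X i j := by
  have h := hA.eigenCoord_cfc_mul hB id X i j
  rwa [cfc_id_eq] at h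

lemma eigenCoord_mul_right (hA : A.IsHermitian) (hB : B.IsHermitian) (X : Matrix n n ℂ) (i j : n) :
    hA.eigenCoord hB (X * B) i j = hA.eigenCoord hB X i j * hB.eigenvalues j := by
  have h := hA.eigenCoord_mul_cfc hB id X i j
  rwa [cfc_id_eq] at h

end Matrix.IsHermitian

namespace Matrix

variable {n : Type*} [Fintype n] [DecidableEq n] {A B : Matrix n n ℂ}

/-- The concave quadratic functional of `X` whose supremum is the quadratic form of the resolvent
at `s` of the relative modular operator `Y ↦ A Y B⁻¹`, evaluated at the square root of `B`. -/
noncomputable def resolventFunctional (A B : Matrix n n ℂ) (s : ℝ) (X : Matrix n n ℂ) : ℝ :=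
  2 * (Xᴴ * B).trace.re - (Xᴴ * (A * X)).trace.re - s * (Xᴴ * (X * B)).trace.re

/-- The supremum of `resolventFunctional A B s`, written in eigenbases of `A` and `B`. -/
noncomputable def resolventSum (hA : A.IsHermitian) (hB : B.IsHermitian) (s : ℝ) : ℝ :=
  ∑ i, ∑ j, ‖hA.eigenCoord hB 1 i j‖ ^ 2 *
    (hB.eigenvalues j ^ 2 / (hA.eigenvalues i + s * hB.eigenvalues j))

lemma resolventFunctional_eq_sum (hA : A.IsHermitian) (hB : B.IsHermitian) (s : ℝ)
    (X : Matrix n n ℂ) :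
    resolventFunctional A B s X = ∑ i, ∑ j,
      (2 * hB.eigenvalues j * (star (hA.eigenCoord hB X i j) * hA.eigenCoord hB 1 i j).re -
        (hA.eigenvalues i + s * hB.eigenvalues j) * ‖hA.eigenCoord hB X i j‖ ^ 2) := by
  have hW (i j : n) := hA.eigenCoord_mul_right hB 1 i j
  simp only [one_mul] at hW
  simp only [resolventFunctional, hA.trace_conjTranspose_mul_eq_sum hB, Complex.re_sum,
    Finset.mul_sum, ← Finset.sum_sub_distrib, hA.eigenCoord_mul_left hB,
    hA.eigenCoord_mul_right hB, hW]
  refine Finset.sum_congr rfl fun i _ ↦ Finset.sum_congr rfl fun j _ ↦ ?_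
  rw [← Complex.normSq_eq_norm_sq, Complex.normSq_apply]
  simp
  ring

lemma two_mul_re_sub_le {p c : ℝ} (hc : 0 < c) (y w : ℂ) :
    2 * p * (star y * w).re - c * ‖y‖ ^ 2 ≤ ‖w‖ ^ 2 * (p ^ 2 / c) := by
  have h : ‖w‖ ^ 2 * (p ^ 2 / c) - (2 * p * (star y * w).re - c * ‖y‖ ^ 2) =
      ((p * w.re - c * y.re) ^ 2 + (p * w.im - c * y.im) ^ 2) / c := by
    simp only [← Complex.normSq_eq_norm_sq, Complex.normSq_apply]
    simp
    field_simp
    ring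
  have : 0 ≤ ((p * w.re - c * y.re) ^ 2 + (p * w.im - c * y.im) ^ 2) / c := by positivity
  linarith

lemma two_mul_re_sub_eq {p c : ℝ} (hc : 0 < c) {y w : ℂ} (h : c * y = p * w) :
    2 * p * (star y * w).re - c * ‖y‖ ^ 2 = ‖w‖ ^ 2 * (p ^ 2 / c) := by
  have hy : y = ((p / c : ℝ) : ℂ) * w := by
    have : (c : ℂ) ≠ 0 := by exact_mod_cast hc.ne'
    push_cast
    field_simp
    rw [mul_comm, h]
  subst hy
  simp only [← Complex.normSq_eq_norm_sq, Complex.normSq_apply]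
  simp
  field_simp
  ring

lemma resolventFunctional_le (hA : A.PosDef) (hB : B.PosDef) {s : ℝ} (hs : 0 ≤ s)
    (X : Matrix n n ℂ) : resolventFunctional A B s X ≤ resolventSum hA.1 hB.1 s := by
  rw [resolventFunctional_eq_sum hA.1 hB.1]
  refine Finset.sum_le_sum fun i _ ↦ Finset.sum_le_sum fun j _ ↦ two_mul_re_sub_le ?_ _ _
  have := hA.eigenvalues_pos i
  have := hB.eigenvalues_pos j
  positivity

lemma resolventFunctional_eq (hA : A.PosDef) (hB : B.PosDef) {s : ℝ} (hs : 0 ≤ s)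
    {X : Matrix n n ℂ} (hX : A * X + (s : ℂ) • (X * B) = B) :
    resolventFunctional A B s X = resolventSum hA.1 hB.1 s := by
  rw [resolventFunctional_eq_sum hA.1 hB.1]
  refine Finset.sum_congr rfl fun i _ ↦ Finset.sum_congr rfl fun j _ ↦ two_mul_re_sub_eq ?_ ?_
  · have := hA.eigenvalues_pos i
    have := hB.eigenvalues_pos j
    positivity
  · have h := congr_fun₂ (congr_arg (hA.1.eigenCoord hB.1) hX) i j
    have h1 := hA.1.eigenCoord_mul_right hB.1 1 i j
    rw [one_mul] at h1
    rw [IsHermitian.eigenCoord_add, IsHermitian.eigenCoord_smul, add_apply, smul_apply,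
      IsHermitian.eigenCoord_mul_left, IsHermitian.eigenCoord_mul_right, h1] at h
    push_cast
    rw [smul_eq_mul] at h
    linear_combination h

lemma exists_mem_sylvester (hA : A.PosDef) (hB : B.PosDef) {s : ℝ} (hs : 0 ≤ s)
    {N : StarSubalgebra ℂ (Matrix n n ℂ)} (hAN : A ∈ N) (hBN : B ∈ N) :
    ∃ X ∈ N, A * X + (s : ℂ) • (X * B) = B := by
  let L : N →ₗ[ℂ] N := LinearMap.mulLeft ℂ (⟨A, hAN⟩ : N) +
    (s : ℂ) • LinearMap.mulRight ℂ (⟨B, hBN⟩ : N)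
  have hL (X : N) : ((L X : N) : Matrix n n ℂ) = A * X + (s : ℂ) • (X * B) := rfl
  have hinj : Function.Injective L := by
    rw [injective_iff_map_eq_zero]
    intro X hX
    have h0 : A * (X : Matrix n n ℂ) + (s : ℂ) • ((X : Matrix n n ℂ) * B) = 0 := by
      rw [← hL, hX]
      rfl
    ext1
    apply hA.1.eigenCoord_injective hB.1
    ext i j
    have h := congr_fun₂ (congr_arg (hA.1.eigenCoord hB.1) h0) i j
    have h1 : hA.1.eigenCoord hB.1 0 = 0 := by simp [IsHermitian.eigenCoord]
    rw [IsHermitian.eigenCoord_add, IsHermitian.eigenCoord_smul, add_apply, smul_apply,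
      IsHermitian.eigenCoord_mul_left, IsHermitian.eigenCoord_mul_right, h1, smul_eq_mul] at h
    have hc : ((hA.1.eigenvalues i + s * hB.1.eigenvalues j : ℝ) : ℂ) ≠ 0 := by
      have := hA.eigenvalues_pos i
      have := hB.eigenvalues_pos j
      exact_mod_cast (show 0 < hA.1.eigenvalues i + s * hB.1.eigenvalues j by positivity).ne'
    rw [ZeroMemClass.coe_zero, h1]
    refine (mul_eq_zero.mp (?_ :
      ((hA.1.eigenvalues i + s * hB.1.eigenvalues j : ℝ) : ℂ) * _ = 0)).resolve_left hc
    push_cast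
    rw [zero_apply] at h
    linear_combination h
  have : FiniteDimensional ℂ N := inferInstanceAs (FiniteDimensional ℂ N.toSubalgebra.toSubmodule)
  obtain ⟨X, hX⟩ := LinearMap.injective_iff_surjective.mp hinj ⟨B, hBN⟩
  exact ⟨X, X.2, by rw [← hL, hX]⟩

lemma IsHermitian.exists_eigenprojection (hA : A.IsHermitian)
    {N : StarSubalgebra ℂ (Matrix n n ℂ)} (hAN : A ∈ N) (i : n) :
    ∃ P ∈ N, P ≠ 0 ∧ Pᴴ = P ∧ P * P = P ∧ A * P = (hA.eigenvalues i : ℂ) • P := by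
  let f : ℝ → ℝ := fun x ↦ if x = hA.eigenvalues i then 1 else 0
  have h1 (k l : n) : hA.eigenCoord hA (hA.cfc f) k l =
      f (hA.eigenvalues k) * hA.eigenCoord hA 1 k l := by
    simpa only [mul_one] using hA.eigenCoord_cfc_mul hA f 1 k l
  refine ⟨hA.cfc f, hA.cfc_mem hAN _, fun h ↦ ?_, hA.conjTranspose_cfc _, ?_, ?_⟩
  · have h2 := h1 i i
    rw [h] at h2
    simp [f, IsHermitian.eigenCoord] at h2
  · rw [hA.cfc_mul_cfc]
    congr 1
    ext x
    simp [f]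
  · apply hA.eigenCoord_injective hA
    ext k l
    rw [hA.eigenCoord_mul_left, hA.eigenCoord_smul, smul_apply, smul_eq_mul, h1]
    by_cases hx : hA.eigenvalues k = hA.eigenvalues i <;> simp [hx, f]

omit [DecidableEq n] in
lemma PosDef.pos_of_trace_eq (hA : A.PosDef) {P : Matrix n n ℂ} (hP : P ≠ 0) {μ : ℝ}
    (h : (Pᴴ * (A * P)).trace = μ * (Pᴴ * P).trace) : 0 < μ := by
  have hpos : 0 < (Pᴴ * P).trace :=
    (posSemidef_conjTranspose_mul_self P).trace_nonneg.lt_of_ne'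
      (by rwa [Ne, trace_conjTranspose_mul_self_eq_zero_iff])
  have hAP : 0 < (Pᴴ * A * P).trace := by
    have hps := hA.posSemidef.conjTranspose_mul_mul_same P
    refine hps.trace_nonneg.lt_of_ne' fun h0 ↦ hP ?_
    rw [hps.trace_eq_zero_iff] at h0
    refine ext_iff_mulVec.mpr fun v ↦ ?_
    by_contra hv
    rw [zero_mulVec] at hv
    have := hA.dotProduct_mulVec_pos hv
    rw [star_mulVec, dotProduct_mulVec, vecMul_vecMul, ← dotProduct_mulVec, mulVec_mulVec, h0,
      zero_mulVec, dotProduct_zero] at this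
    exact this.false
  rw [mul_assoc, h] at hAP
  exact_mod_cast pos_of_mul_pos_left hAP hpos.le

/-- `E` is the Hilbert–Schmidt orthogonal projection onto `N`. -/
structure IsTraceProjection (N : StarSubalgebra ℂ (Matrix n n ℂ))
    (E : Matrix n n ℂ → Matrix n n ℂ) : Prop where
  mem (X) : E X ∈ N
  orth (X) : ∀ Y ∈ N, (Yᴴ * (X - E X)).trace = 0

namespace IsTraceProjection

variable {N : StarSubalgebra ℂ (Matrix n n ℂ)} {E : Matrix n n ℂ → Matrix n n ℂ}

lemma trace_mul (hE : IsTraceProjection N E) (X : Matrix n n ℂ) {Y : Matrix n n ℂ} (hY : Y ∈ N) :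
    (Y * E X).trace = (Y * X).trace := by
  have h := hE.orth X _ (star_mem hY)
  rw [star_eq_conjTranspose, conjTranspose_conjTranspose, mul_sub, trace_sub] at h
  exact (sub_eq_zero.mp h).symm

lemma isHermitian (hE : IsTraceProjection N E) {A : Matrix n n ℂ} (hA : A.IsHermitian) :
    (E A).IsHermitian := by
  have hm := hE.mem A
  have hm' : (E A)ᴴ ∈ N := star_mem hm
  have hD : (E A)ᴴ - E A ∈ N := sub_mem hm' hm
  have hD' : ((E A)ᴴ - E A)ᴴ ∈ N := star_mem hD
  rw [IsHermitian, ← sub_eq_zero, ← trace_conjTranspose_mul_self_eq_zero_iff, mul_sub, trace_sub,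
    hE.trace_mul A hD', ← star_inj, star_sub, ← trace_conjTranspose, ← trace_conjTranspose]
  simp only [conjTranspose_mul, conjTranspose_conjTranspose, hA.eq]
  rw [trace_mul_comm, hE.trace_mul A hD, trace_mul_comm A]
  simp

lemma posDef (hE : IsTraceProjection N E) {A : Matrix n n ℂ} (hA : A.PosDef) :
    (E A).PosDef := by
  have hH := hE.isHermitian hA.1
  rw [hH.posDef_iff_eigenvalues_pos]
  intro i
  obtain ⟨P, hPN, hP0, hPH, hPP, hEP⟩ := hH.exists_eigenprojection (hE.mem A) i
  refine hA.pos_of_trace_eq hP0 ?_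
  rw [hPH, trace_mul_comm, mul_assoc, hPP, trace_mul_comm, ← hE.trace_mul A hPN,
    trace_mul_comm, hEP, trace_smul, smul_eq_mul]

lemma resolventSum_le (hE : IsTraceProjection N E) (hA : A.PosDef) (hB : B.PosDef) {s : ℝ}
    (hs : 0 ≤ s) :
    resolventSum (hE.posDef hA).1 (hE.posDef hB).1 s ≤ resolventSum hA.1 hB.1 s := by
  obtain ⟨X, hX, h⟩ := exists_mem_sylvester (hE.posDef hA) (hE.posDef hB) hs (hE.mem A) (hE.mem B)
  have hX' : Xᴴ ∈ N := star_mem hX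
  rw [← resolventFunctional_eq (hE.posDef hA) (hE.posDef hB) hs h]
  refine le_trans (le_of_eq ?_) (resolventFunctional_le hA hB hs X)
  have h1 (C : Matrix n n ℂ) : (Xᴴ * (C * X)).trace = (X * Xᴴ * C).trace := by
    rw [← mul_assoc, trace_mul_cycle]
  simp only [resolventFunctional, h1]
  simp only [← mul_assoc, hE.trace_mul _ hX', hE.trace_mul _ (mul_mem hX hX'),
    hE.trace_mul _ (mul_mem hX' hX)]

end IsTraceProjection

end Matrix

open Filter Topology

namespace Matrix

variable {n : Type*} [Fintype n] [DecidableEq n] {A B A' B' : Matrix n n ℂ}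

/-- An antiderivative of `resolventSum` in the parameter `s`. -/
noncomputable def logSum (hA : A.IsHermitian) (hB : B.IsHermitian) (s : ℝ) : ℝ :=
  ∑ i, ∑ j, ‖hA.eigenCoord hB 1 i j‖ ^ 2 * (hB.eigenvalues j *
    (Real.log (hA.eigenvalues i + s * hB.eigenvalues j) - Real.log (hA.eigenvalues i)))

/-- The Umegaki relative entropy of `B` with respect to `A`, written in eigenbases. -/
noncomputable def relEntSum (hA : A.IsHermitian) (hB : B.IsHermitian) : ℝ :=
  ∑ i, ∑ j, ‖hA.eigenCoord hB 1 i j‖ ^ 2 * (hB.eigenvalues j *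
    (Real.log (hB.eigenvalues j) - Real.log (hA.eigenvalues i)))

lemma trace_re_eq_sum (hA : A.IsHermitian) (hB : B.IsHermitian) :
    B.trace.re = ∑ i, ∑ j, ‖hA.eigenCoord hB 1 i j‖ ^ 2 * hB.eigenvalues j := by
  have h := hA.trace_cfc_mul_cfc hB id 1
  rw [hB.cfc_id_eq, hA.cfc_one_eq, mul_one] at h
  simpa using h

lemma logSum_zero (hA : A.IsHermitian) (hB : B.IsHermitian) : logSum hA hB 0 = 0 := by
  simp [logSum]

lemma hasDerivAt_logSum (hA : A.PosDef) (hB : B.PosDef) {s : ℝ} (hs : 0 ≤ s) :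
    HasDerivAt (logSum hA.1 hB.1) (resolventSum hA.1 hB.1 s) s := by
  refine HasDerivAt.fun_sum fun i _ ↦ HasDerivAt.fun_sum fun j _ ↦ HasDerivAt.const_mul _ ?_
  have hq := hA.eigenvalues_pos i
  have hp := hB.eigenvalues_pos j
  have h1 : HasDerivAt (fun s : ℝ ↦ hA.1.eigenvalues i + s * hB.1.eigenvalues j)
      (hB.1.eigenvalues j) s := by
    simpa using ((hasDerivAt_id s).mul_const (hB.1.eigenvalues j)).const_add (hA.1.eigenvalues i)
  have h2 := ((h1.log (by positivity)).sub_const (Real.log (hA.1.eigenvalues i))).const_mul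
    (hB.1.eigenvalues j)
  convert h2 using 1
  ring

lemma tendsto_logSum_sub (hA : A.PosDef) (hB : B.PosDef) :
    Tendsto (fun s ↦ logSum hA.1 hB.1 s - B.trace.re * Real.log s) atTop
      (𝓝 (relEntSum hA.1 hB.1)) := by
  simp only [trace_re_eq_sum hA.1 hB.1, logSum, Finset.sum_mul, ← Finset.sum_sub_distrib]
  refine tendsto_finsetSum _ fun i _ ↦ tendsto_finsetSum _ fun j _ ↦ ?_
  have hq := hA.eigenvalues_pos i
  have hp := hB.eigenvalues_pos j
  set q := hA.1.eigenvalues i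
  set p := hB.1.eigenvalues j
  have h1 : Tendsto (fun s : ℝ ↦ q / s + p) atTop (𝓝 p) := by
    simpa using (tendsto_const_nhds.div_atTop tendsto_id).add_const p
  have h2 := (((h1.log hp.ne').sub_const (Real.log q)).const_mul p).const_mul
    (‖hA.1.eigenCoord hB.1 1 i j‖ ^ 2)
  refine h2.congr' ?_
  filter_upwards [eventually_gt_atTop 0] with s hs
  have h3 : q / s + p = (q + s * p) / s := by field_simp
  rw [h3, Real.log_div (by positivity) hs.ne']
  ring

lemma relEntSum_le_of_resolventSum_le (hA : A.PosDef) (hB : B.PosDef) (hA' : A'.PosDef)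
    (hB' : B'.PosDef) (htr : B'.trace.re = B.trace.re)
    (h : ∀ s, 0 ≤ s → resolventSum hA'.1 hB'.1 s ≤ resolventSum hA.1 hB.1 s) :
    relEntSum hA'.1 hB'.1 ≤ relEntSum hA.1 hB.1 := by
  have hderiv (s : ℝ) (hs : 0 ≤ s) :=
    (hasDerivAt_logSum hA hB hs).sub (hasDerivAt_logSum hA' hB' hs)
  have hmono : MonotoneOn (logSum hA.1 hB.1 - logSum hA'.1 hB'.1) (Set.Ici 0) := by
    refine monotoneOn_of_hasDerivWithinAt_nonneg (convex_Ici 0)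
      (fun s hs ↦ (hderiv s hs).continuousAt.continuousWithinAt)
      (fun s hs ↦ (hderiv s (interior_subset hs)).hasDerivWithinAt)
      fun s hs ↦ sub_nonneg.mpr (h s (interior_subset hs))
  refine le_of_tendsto_of_tendsto (tendsto_logSum_sub hA' hB') (tendsto_logSum_sub hA hB) ?_
  filter_upwards [eventually_ge_atTop 0] with s hs
  have := hmono Set.self_mem_Ici hs hs
  simp only [Pi.sub_apply, logSum_zero, sub_zero] at this
  rw [htr]
  linarith

end Matrix

section relEnt

variable {d : ℕ} {ρ σ : Matrix (Fin d) (Fin d) ℂ}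

lemma matLog_eq_cfc (hσ : σ.IsHermitian) : matLog σ = hσ.cfc Real.log := dif_pos hσ

lemma relEnt_eq_relEntSum (hρ : ρ.IsHermitian) (hσ : σ.IsHermitian) :
    relEnt ρ σ = relEntSum hσ hρ := by
  have h1 := hσ.trace_cfc_mul_cfc hρ id Real.log
  have h2 := hσ.trace_cfc_mul_cfc hρ (id * Real.log) 1
  rw [← hρ.cfc_mul_cfc, hσ.cfc_one_eq, mul_one] at h2
  rw [hρ.cfc_id_eq] at h1 h2
  rw [relEnt, matLog_eq_cfc hρ, matLog_eq_cfc hσ, mul_sub, trace_sub, Complex.sub_re, h1, h2]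
  simp only [relEntSum, ← Finset.sum_sub_distrib]
  refine Finset.sum_congr rfl fun i _ ↦ Finset.sum_congr rfl fun j _ ↦ ?_
  simp
  ring

/-- Data processing inequality for a trace-preserving conditional expectation. -/
lemma Matrix.IsTraceProjection.relEnt_le {N : StarSubalgebra ℂ (Matrix (Fin d) (Fin d) ℂ)}
    {E : Matrix (Fin d) (Fin d) ℂ → Matrix (Fin d) (Fin d) ℂ} (hE : IsTraceProjection N E)
    (hρ : ρ.PosDef) (hσ : σ.PosDef) : relEnt (E ρ) (E σ) ≤ relEnt ρ σ := by
  rw [relEnt_eq_relEntSum (hE.posDef hρ).1 (hE.posDef hσ).1, relEnt_eq_relEntSum hρ.1 hσ.1]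
  refine relEntSum_le_of_resolventSum_le hσ hρ (hE.posDef hσ) (hE.posDef hρ) ?_
    fun s hs ↦ hE.resolventSum_le hσ hρ hs
  have h := hE.trace_mul ρ (one_mem N)
  rw [one_mul, one_mul] at h
  rw [h]

lemma matLog_mem {N : StarSubalgebra ℂ (Matrix (Fin d) (Fin d) ℂ)} (hσ : σ ∈ N) :
    matLog σ ∈ N := by
  unfold matLog
  split_ifs with h
  · exact h.cfc_mem hσ _
  · exact zero_mem N

end relEnt


/-- **Lemma 3.2 (tracial case).**  Here `E` is the orthogonal projection onto the unital
*-subalgebra `N` with respect to the Hilbert–Schmidt inner product `⟨X, Y⟩ = tr (Xᴴ Y)`. -/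
theorem relEnt_subadd_conditional_expectation
    (d : ℕ) (N : StarSubalgebra ℂ (Matrix (Fin d) (Fin d) ℂ))
    (E : Matrix (Fin d) (Fin d) ℂ →ₗ[ℂ] Matrix (Fin d) (Fin d) ℂ)
    (hEmem : ∀ X : Matrix (Fin d) (Fin d) ℂ, E X ∈ N)
    (hEfix : ∀ X ∈ N, E X = X)
    (hEorth : ∀ X : Matrix (Fin d) (Fin d) ℂ, ∀ Y ∈ N, (Yᴴ * (X - E X)).trace = 0)
    (ρ ω : Matrix (Fin d) (Fin d) ℂ)
    (hρ : ρ.PosDef) (hρtr : ρ.trace = 1)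
    (hω : ω.PosDef) (hωtr : ω.trace = 1) :
    relEnt ρ (E ρ) + relEnt ρ ω ≥ relEnt ρ (E ω) := by
  have hE : IsTraceProjection N E := ⟨hEmem, hEorth⟩
  have h := hE.relEnt_le hρ hω
  have key (X : Matrix (Fin d) (Fin d) ℂ) :
      (E ρ * matLog (E X)).trace = (ρ * matLog (E X)).trace := by
    rw [trace_mul_comm, hE.trace_mul ρ (matLog_mem (hEmem X)), trace_mul_comm]
  simp only [relEnt, mul_sub, trace_sub, Complex.sub_re, key] at h ⊢
  linarith
end

section
/- Let N_1, …, N_J (J ∈ ℕ) be unital *-subalgebras of the d×d complex matrices, with E_j the Hilbert–Schmidt orthogonal projection onto N_j. Let S be a finite set of finite nonempty sequences with entries in {1,…,J}, with weights μ : S → [0,1] summing to 1; for s = (j_1,…,j_m) ∈ S write E^s := E_{j_1} ∘ ⋯ ∘ E_{j_m}, and let k_{s,j} be a natural number that is at least the number of occurrences of j in s. Then for every positive definite density ρ: Σ_{s∈S} μ(s) · Σ_{j=1}^J k_{s,j} · D(ρ‖E_j(ρ)) ≥ D(ρ ‖ Σ_{s∈S} μ(s)·E^s(ρ)). -/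
open Matrix
open scoped ComplexOrder

/-- Composition `E^s = E_{j₁} ∘ ⋯ ∘ E_{jₘ}` of a finite sequence of linear maps. -/
def compSeq {d J : ℕ}
    (Es : Fin J → (Matrix (Fin d) (Fin d) ℂ →ₗ[ℂ] Matrix (Fin d) (Fin d) ℂ)) :
    List (Fin J) → (Matrix (Fin d) (Fin d) ℂ →ₗ[ℂ] Matrix (Fin d) (Fin d) ℂ) :=
  fun s => s.foldr (fun j acc => (Es j).comp acc) LinearMap.id

section SpectralDecomposition

variable {d : ℕ}

/-- The real-valued functional calculus of a Hermitian matrix stays inside every star subalgebra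
containing the matrix. -/
theorem cfc_mem_starSubalgebra (N : StarSubalgebra ℂ (Matrix (Fin d) (Fin d) ℂ))
    {A : Matrix (Fin d) (Fin d) ℂ} (hA : A.IsHermitian) (hAN : A ∈ N) (f : ℝ → ℝ) :
    hA.cfc f ∈ N := by
  rw [← hA.cfc_eq]
  have hclosed : IsClosed (N : Set (Matrix (Fin d) (Fin d) ℂ)) :=
    (Subalgebra.toSubmodule N.toSubalgebra).closed_of_finiteDimensional
  exact cfc_mem (𝕜' := ℂ) (hs := hclosed) f hAN

theorem cfc_eq_conj_diagonal {A : Matrix (Fin d) (Fin d) ℂ} (hA : A.IsHermitian) (f : ℝ → ℝ) :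
    hA.cfc f = (hA.eigenvectorUnitary : Matrix (Fin d) (Fin d) ℂ)
      * diagonal (fun i => ((f (hA.eigenvalues i) : ℝ) : ℂ))
      * (hA.eigenvectorUnitary : Matrix (Fin d) (Fin d) ℂ)ᴴ := by
  simp only [IsHermitian.cfc, Unitary.conjStarAlgAut_apply]
  rfl

theorem exists_diagonalization {ρ : Matrix (Fin d) (Fin d) ℂ} (hρ : ρ.PosDef) :
    ∃ (U : Matrix (Fin d) (Fin d) ℂ) (p : Fin d → ℝ), Uᴴ * U = 1 ∧ U * Uᴴ = 1 ∧ (∀ i, 0 < p i) ∧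
      ρ = U * diagonal (fun i => (p i : ℂ)) * Uᴴ ∧
      matLog ρ = U * diagonal (fun i => (Real.log (p i) : ℂ)) * Uᴴ := by
  refine ⟨hρ.1.eigenvectorUnitary, hρ.1.eigenvalues, Unitary.coe_star_mul_self _,
    Unitary.coe_mul_star_self _, hρ.eigenvalues_pos, ?_, ?_⟩
  · conv_lhs => rw [hρ.1.spectral_theorem, Unitary.conjStarAlgAut_apply]
    rfl
  · rw [matLog, dif_pos hρ.1, cfc_eq_conj_diagonal]

theorem trace_conj_diagonal_mul (U V : Matrix (Fin d) (Fin d) ℂ) (p q : Fin d → ℝ) :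
    ((U * diagonal (fun i => (p i : ℂ)) * Uᴴ)
      * (V * diagonal (fun i => (q i : ℂ)) * Vᴴ)).trace.re
      = ∑ i, ∑ j, Complex.normSq ((Vᴴ * U) j i) * p i * q j := by
  have h : ((U * diagonal (fun i => (p i : ℂ)) * Uᴴ)
      * (V * diagonal (fun i => (q i : ℂ)) * Vᴴ)).trace
      = (diagonal (fun i => (p i : ℂ)) * ((Vᴴ * U)ᴴ * (diagonal (fun i => (q i : ℂ))
        * (Vᴴ * U)))).trace := by
    rw [mul_assoc, mul_assoc, trace_mul_comm U]
    simp only [conjTranspose_mul, conjTranspose_conjTranspose, mul_assoc]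
  rw [h]
  simp only [trace, diag, diagonal_mul, mul_apply (M := (Vᴴ * U)ᴴ), Complex.re_sum, Finset.mul_sum,
    conjTranspose_apply (Vᴴ * U)]
  refine Finset.sum_congr rfl fun i _ => Finset.sum_congr rfl fun j _ => ?_
  rw [← Complex.ofReal_re (_ * _ * _)]
  congr 1
  push_cast
  rw [Complex.normSq_eq_conj_mul_self, ← Complex.star_def]
  ring

end SpectralDecomposition

section Variational

variable {d : ℕ}

/-- The concave quadratic functional whose supremum over `Y` is the value at `t` of the resolvent
form of the relative modular operator of `(ρ, τ)`. -/
noncomputable def modularForm (ρ τ : Matrix (Fin d) (Fin d) ℂ) (t : ℝ)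
    (Y : Matrix (Fin d) (Fin d) ℂ) : ℝ :=
  2 * (Yᴴ * ρ).trace.re - (Yᴴ * τ * Y).trace.re - t * (Y * ρ * Yᴴ).trace.re

theorem re_trace_conjTranspose (A : Matrix (Fin d) (Fin d) ℂ) : Aᴴ.trace.re = A.trace.re := by
  simp [trace_conjTranspose]

/-- Expansion of `modularForm` around a point. -/
theorem modularForm_add {ρ τ : Matrix (Fin d) (Fin d) ℂ} (hρ : ρ.IsHermitian)
    (hτ : τ.IsHermitian) (t : ℝ) (Y H : Matrix (Fin d) (Fin d) ℂ) :
    modularForm ρ τ t (Y + H) = modularForm ρ τ t Y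
      + 2 * (Hᴴ * (ρ - (τ * Y + (t : ℂ) • (Y * ρ)))).trace.re
      - (Hᴴ * τ * H).trace.re - t * (H * ρ * Hᴴ).trace.re := by
  have h1 : (Yᴴ * τ * H).trace.re = (Hᴴ * τ * Y).trace.re := by
    rw [← re_trace_conjTranspose]
    simp [conjTranspose_mul, hτ.eq, mul_assoc]
  have h2 : (H * ρ * Yᴴ).trace.re = (Y * ρ * Hᴴ).trace.re := by
    rw [← re_trace_conjTranspose]
    simp [conjTranspose_mul, hρ.eq, mul_assoc]
  have h3 : (Hᴴ * (Y * ρ)).trace.re = (Y * ρ * Hᴴ).trace.re := by rw [trace_mul_comm]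
  simp only [modularForm, conjTranspose_add, add_mul, mul_add, mul_sub, trace_add, trace_sub,
    Complex.add_re, Complex.sub_re, mul_smul_comm, trace_smul, smul_eq_mul, Complex.re_ofReal_mul,
    h1, h2, h3, ← mul_assoc Hᴴ τ Y]
  ring

theorem modularForm_add_le {ρ τ : Matrix (Fin d) (Fin d) ℂ} (hρ : ρ.PosDef) (hτ : τ.PosDef)
    {t : ℝ} (ht : 0 ≤ t) {Y H : Matrix (Fin d) (Fin d) ℂ}
    (hH : (Hᴴ * (ρ - (τ * Y + (t : ℂ) • (Y * ρ)))).trace = 0) :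
    modularForm ρ τ t (Y + H) ≤ modularForm ρ τ t Y := by
  have h1 : 0 ≤ (Hᴴ * τ * H).trace.re :=
    (Complex.le_def.1 (hτ.posSemidef.conjTranspose_mul_mul_same H).trace_nonneg).1
  have h2 : 0 ≤ (H * ρ * Hᴴ).trace.re :=
    (Complex.le_def.1 (hρ.posSemidef.mul_mul_conjTranspose_same H).trace_nonneg).1
  rw [modularForm_add hρ.1 hτ.1, hH, Complex.zero_re]
  nlinarith

theorem modularForm_isGreatest {ρ τ : Matrix (Fin d) (Fin d) ℂ} (hρ : ρ.PosDef) (hτ : τ.PosDef)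
    {t : ℝ} (ht : 0 ≤ t) {Y : Matrix (Fin d) (Fin d) ℂ}
    (hY : τ * Y + (t : ℂ) • (Y * ρ) = ρ) :
    IsGreatest (Set.range (modularForm ρ τ t)) (Yᴴ * ρ).trace.re := by
  have hval : modularForm ρ τ t Y = (Yᴴ * ρ).trace.re := by
    have h := congrArg (fun A => (Yᴴ * A).trace.re) hY
    simp only [mul_add, trace_add, Complex.add_re, mul_smul_comm, trace_smul, smul_eq_mul,
      Complex.re_ofReal_mul, trace_mul_comm Yᴴ (Y * ρ)] at h
    rw [modularForm, mul_assoc Yᴴ τ Y]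
    linarith
  refine ⟨⟨Y, hval⟩, ?_⟩
  rintro _ ⟨Z, rfl⟩
  have h := modularForm_add_le hρ hτ ht (Y := Y) (H := Z - Y) (by rw [hY]; simp)
  rwa [add_sub_cancel, hval] at h

open Filter Topology in
/-- The relative entropy is the regularized limit of a potential whose derivative is the maximum of
`modularForm`. -/
theorem exists_modularForm_potential {ρ τ : Matrix (Fin d) (Fin d) ℂ} (hρ : ρ.PosDef)
    (hτ : τ.PosDef) :
    ∃ f : ℝ → ℝ, f 0 = 0 ∧
      (∀ t, 0 ≤ t → ∃ m, HasDerivAt f m t ∧ IsGreatest (Set.range (modularForm ρ τ t)) m) ∧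
      Tendsto (fun T => f T - ρ.trace.re * Real.log T) atTop (𝓝 (relEnt ρ τ)) := by
  obtain ⟨U, p, hU, -, hp, hρU, hlogρ⟩ := exists_diagonalization hρ
  obtain ⟨V, q, hV, hV', hq, hτV, hlogτ⟩ := exists_diagonalization hτ
  have hone : V * diagonal (fun _ => ((1 : ℝ) : ℂ)) * Vᴴ = 1 := by
    simpa [diagonal_one] using hV'
  have htrace : ∀ r : Fin d → ℝ, (U * diagonal (fun i => (r i : ℂ)) * Uᴴ).trace.re
      = ∑ i, ∑ j, Complex.normSq ((Vᴴ * U) j i) * r i := by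
    intro r
    have h := trace_conj_diagonal_mul U V r (fun _ => 1)
    rw [hone, mul_one] at h
    simpa using h
  have hent : relEnt ρ τ = ∑ i, ∑ j, Complex.normSq ((Vᴴ * U) j i) * p i
      * (Real.log (p i) - Real.log (q j)) := by
    have h1 : ρ * matLog ρ = U * diagonal (fun i => ((p i * Real.log (p i) : ℝ) : ℂ)) * Uᴴ := by
      rw [hlogρ]
      nth_rewrite 1 [hρU]
      calc _ = U * diagonal (fun i => (p i : ℂ)) * (Uᴴ * U)
            * diagonal (fun i => (Real.log (p i) : ℂ)) * Uᴴ := by simp only [mul_assoc]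
        _ = _ := by rw [hU, mul_one, mul_assoc U, diagonal_mul_diagonal]; push_cast; rfl
    have h2 : (ρ * matLog τ).trace.re
        = ∑ i, ∑ j, Complex.normSq ((Vᴴ * U) j i) * p i * Real.log (q j) := by
      rw [hlogτ, hρU, trace_conj_diagonal_mul]
    rw [relEnt, mul_sub, trace_sub, Complex.sub_re, h1, htrace, h2, ← Finset.sum_sub_distrib]
    refine Finset.sum_congr rfl fun i _ => ?_
    rw [← Finset.sum_sub_distrib]
    exact Finset.sum_congr rfl fun j _ => by ring
  have hpos : ∀ t, 0 ≤ t → ∀ i j, 0 < q j + t * p i := fun t ht i j =>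
    add_pos_of_pos_of_nonneg (hq j) (mul_nonneg ht (hp i).le)
  refine ⟨fun T => ∑ i, ∑ j, Complex.normSq ((Vᴴ * U) j i) * p i
      * (Real.log (q j + T * p i) - Real.log (q j)), by simp, fun t ht => ?_, ?_⟩
  · refine ⟨∑ i, ∑ j, Complex.normSq ((Vᴴ * U) j i) * p i * (p i / (q j + t * p i)), ?_, ?_⟩
    · refine HasDerivAt.fun_sum fun i _ => HasDerivAt.fun_sum fun j _ => ?_
      have h : HasDerivAt (fun T : ℝ => q j + T * p i) (p i) t := by
        simpa using ((hasDerivAt_id t).mul_const (p i)).const_add (q j)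
      exact ((h.log (hpos t ht i j).ne').sub_const _).const_mul _
    · set C := Vᴴ * U with hC
      set M : Matrix (Fin d) (Fin d) ℂ := of fun j i => C j i * ((p i / (q j + t * p i) : ℝ) : ℂ)
      have hMapply : ∀ j i, M j i = C j i * ((p i / (q j + t * p i) : ℝ) : ℂ) := fun _ _ => rfl
      have hMeq : diagonal (fun i => (q i : ℂ)) * M + (t : ℂ) • (M * diagonal (fun i => (p i : ℂ)))
          = C * diagonal (fun i => (p i : ℂ)) := by
        ext j i
        have hne : (q j : ℂ) + p i * t ≠ 0 := by
          exact_mod_cast mul_comm t (p i) ▸ (hpos t ht i j).ne'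
        simp only [Matrix.add_apply, Matrix.smul_apply, diagonal_mul, mul_diagonal, hMapply,
          smul_eq_mul]
        push_cast
        field_simp
      have hY : τ * (V * M * Uᴴ) + (t : ℂ) • (V * M * Uᴴ * ρ) = ρ := by
        have h1 : τ * (V * M * Uᴴ) = V * (diagonal (fun i => (q i : ℂ)) * M) * Uᴴ := by
          calc _ = V * diagonal (fun i => (q i : ℂ)) * (Vᴴ * V) * M * Uᴴ := by
                rw [hτV]; simp only [mul_assoc]
            _ = _ := by rw [hV, mul_one]; simp only [mul_assoc]
        have h2 : V * M * Uᴴ * ρ = V * (M * diagonal (fun i => (p i : ℂ))) * Uᴴ := by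
          calc _ = V * M * (Uᴴ * U) * diagonal (fun i => (p i : ℂ)) * Uᴴ := by
                rw [hρU]; simp only [mul_assoc]
            _ = _ := by rw [hU, mul_one]; simp only [mul_assoc]
        rw [h1, h2, ← smul_mul_assoc, ← mul_smul_comm, ← add_mul, ← mul_add, hMeq, hC]
        calc _ = (V * Vᴴ) * (U * diagonal (fun i => (p i : ℂ)) * Uᴴ) := by simp only [mul_assoc]
          _ = ρ := by rw [hV', one_mul, ← hρU]
      convert modularForm_isGreatest hρ hτ ht hY using 1
      have h : ((V * M * Uᴴ)ᴴ * ρ).trace = (Mᴴ * (C * diagonal (fun i => (p i : ℂ)))).trace := by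
        calc _ = (U * (Mᴴ * (C * diagonal (fun i => (p i : ℂ)) * Uᴴ))).trace := by
              rw [hρU, hC]
              simp only [conjTranspose_mul, conjTranspose_conjTranspose, mul_assoc]
          _ = (Mᴴ * (C * diagonal (fun i => (p i : ℂ))) * (Uᴴ * U)).trace := by
              rw [trace_mul_comm]
              simp only [mul_assoc]
          _ = _ := by rw [hU, mul_one]
      rw [h]
      simp only [trace, diag, mul_apply (M := Mᴴ), Complex.re_sum, conjTranspose_apply,
        mul_diagonal, hMapply]
      refine Finset.sum_congr rfl fun i _ => Finset.sum_congr rfl fun j _ => ?_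
      rw [← Complex.ofReal_re (_ * _ * _)]
      congr 1
      rw [star_mul', Complex.star_def, Complex.conj_ofReal]
      push_cast
      rw [Complex.normSq_eq_conj_mul_self]
      ring
  · have htr : ρ.trace.re = ∑ i, ∑ j, Complex.normSq ((Vᴴ * U) j i) * p i := by
      conv_lhs => rw [hρU, htrace]
    rw [hent, htr]
    simp only [Finset.sum_mul, ← Finset.sum_sub_distrib]
    refine tendsto_finsetSum _ fun i _ => tendsto_finsetSum _ fun j _ => ?_
    have hlim : Tendsto (fun T : ℝ => Real.log (q j / T + p i)) atTop (𝓝 (Real.log (p i))) := by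
      have h : Tendsto (fun T : ℝ => q j / T + p i) atTop (𝓝 (p i)) := by
        simpa using (tendsto_const_nhds (x := q j)).div_atTop tendsto_id |>.add_const (p i)
      exact h.log (hp i).ne'
    refine ((hlim.sub_const (Real.log (q j))).const_mul
      (Complex.normSq ((Vᴴ * U) j i) * p i)).congr' ?_
    filter_upwards [eventually_gt_atTop 0] with T hT
    have h : q j / T + p i = (q j + T * p i) / T := by field_simp
    rw [h, Real.log_div (hpos T hT.le i j).ne' hT.ne']
    ring

open Filter in
/-- A domination between the forms `modularForm` passes to the relative entropies. -/
theorem relEnt_le_sum_of_modularForm_le {ι : Type*} (s : Finset ι) {c : ι → ℝ}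
    (hc : ∀ a ∈ s, 0 ≤ c a) {ρ τ : Matrix (Fin d) (Fin d) ℂ} (hρ : ρ.PosDef) (hτ : τ.PosDef)
    {ρs τs : ι → Matrix (Fin d) (Fin d) ℂ} (hρs : ∀ a, (ρs a).PosDef) (hτs : ∀ a, (τs a).PosDef)
    (htr : ρ.trace.re = ∑ a ∈ s, c a * (ρs a).trace.re)
    (h : ∀ t, 0 ≤ t → ∀ Y, ∃ Z,
      modularForm ρ τ t Y ≤ ∑ a ∈ s, c a * modularForm (ρs a) (τs a) t Z) :
    relEnt ρ τ ≤ ∑ a ∈ s, c a * relEnt (ρs a) (τs a) := by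
  obtain ⟨f, hf0, hf, hflim⟩ := exists_modularForm_potential hρ hτ
  choose g hg0 hg hglim using fun a => exists_modularForm_potential (hρs a) (hτs a)
  have hderiv : ∀ t, 0 ≤ t → ∃ m, 0 ≤ m ∧
      HasDerivAt (fun T => ∑ a ∈ s, c a * g a T - f T) m t := by
    intro t ht
    obtain ⟨m, hm, ⟨Y, rfl⟩, -⟩ := hf t ht
    choose n hn hn' using fun a => hg a t ht
    refine ⟨∑ a ∈ s, c a * n a - modularForm ρ τ t Y, ?_,
      (HasDerivAt.fun_sum fun a _ => (hn a).const_mul (c a)).sub hm⟩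
    obtain ⟨Z, hZ⟩ := h t ht Y
    exact sub_nonneg.2 (hZ.trans (Finset.sum_le_sum fun a ha =>
      mul_le_mul_of_nonneg_left ((hn' a).2 ⟨Z, rfl⟩) (hc a ha)))
  have hmono : MonotoneOn (fun T => ∑ a ∈ s, c a * g a T - f T) (Set.Ici 0) := by
    refine monotoneOn_of_deriv_nonneg (convex_Ici 0) (fun t ht => ?_) (fun t ht => ?_)
      (fun t ht => ?_)
    · obtain ⟨m, -, hm⟩ := hderiv t ht
      exact hm.continuousAt.continuousWithinAt
    · obtain ⟨m, -, hm⟩ := hderiv t (interior_subset ht)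
      exact hm.differentiableAt.differentiableWithinAt
    · obtain ⟨m, hm0, hm⟩ := hderiv t (interior_subset ht)
      rwa [hm.deriv]
  refine le_of_tendsto_of_tendsto hflim
    (tendsto_finsetSum s fun a _ => (hglim a).const_mul (c a)) ?_
  filter_upwards [eventually_ge_atTop 0] with T hT
  have hT' := hmono (Set.mem_Ici.2 le_rfl) (Set.mem_Ici.2 hT) hT
  simp only [hf0, hg0, mul_zero, Finset.sum_const_zero, sub_zero] at hT'
  simp only [mul_sub, Finset.sum_sub_distrib, htr, Finset.sum_mul, mul_assoc]
  linarith

end Variational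

section ConditionalExpectation

variable {d : ℕ}

/-- `E` is the Hilbert-Schmidt orthogonal projection onto the star subalgebra `N`. -/
structure IsHSProjection (N : StarSubalgebra ℂ (Matrix (Fin d) (Fin d) ℂ))
    (E : Matrix (Fin d) (Fin d) ℂ →ₗ[ℂ] Matrix (Fin d) (Fin d) ℂ) : Prop where
  mem : ∀ X, E X ∈ N
  orthogonal : ∀ X, ∀ Y ∈ N, (Yᴴ * (X - E X)).trace = 0

namespace IsHSProjection

variable {N : StarSubalgebra ℂ (Matrix (Fin d) (Fin d) ℂ)}
  {E : Matrix (Fin d) (Fin d) ℂ →ₗ[ℂ] Matrix (Fin d) (Fin d) ℂ}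

theorem trace_mul_apply (hE : IsHSProjection N E) (X : Matrix (Fin d) (Fin d) ℂ)
    {Y : Matrix (Fin d) (Fin d) ℂ} (hY : Y ∈ N) : (Y * E X).trace = (Y * X).trace := by
  have h := hE.orthogonal X Yᴴ (star_mem hY)
  rw [conjTranspose_conjTranspose, mul_sub, trace_sub, sub_eq_zero] at h
  exact h.symm

theorem apply_eq_of_trace (hE : IsHSProjection N E) {X A : Matrix (Fin d) (Fin d) ℂ} (hA : A ∈ N)
    (h : ∀ Y ∈ N, (Y * A).trace = (Y * X).trace) : E X = A := by
  have hmem : E X - A ∈ N := sub_mem (hE.mem X) hA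
  have hmem' : (E X - A)ᴴ ∈ N := star_mem hmem
  rw [← sub_eq_zero, ← trace_conjTranspose_mul_self_eq_zero_iff, mul_sub, trace_sub,
    hE.trace_mul_apply X hmem', h _ hmem', sub_self]

theorem apply_isHermitian (hE : IsHSProjection N E) {X : Matrix (Fin d) (Fin d) ℂ}
    (hX : X.IsHermitian) : (E X).IsHermitian := by
  refine (hE.apply_eq_of_trace (star_mem (hE.mem X)) fun Y hY => ?_).symm
  have hY' : Yᴴ ∈ N := star_mem hY
  calc (Y * (E X)ᴴ).trace = star ((Yᴴ * E X).trace) := by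
        rw [← trace_conjTranspose, conjTranspose_mul, conjTranspose_conjTranspose, trace_mul_comm]
    _ = (Y * X).trace := by
        rw [hE.trace_mul_apply X hY', ← trace_conjTranspose, conjTranspose_mul,
          conjTranspose_conjTranspose, hX.eq, trace_mul_comm]

theorem apply_posDef (hE : IsHSProjection N E) {X : Matrix (Fin d) (Fin d) ℂ}
    (hX : X.PosDef) : (E X).PosDef := by
  have hH := hE.apply_isHermitian hX.1
  rw [hH.posDef_iff_eigenvalues_pos]
  by_contra! hneg
  obtain ⟨i₀, hi₀⟩ := hneg
  set f : ℝ → ℝ := fun x => if x ≤ 0 then 1 else 0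
  set U := (hH.eigenvectorUnitary : Matrix (Fin d) (Fin d) ℂ) with hUdef
  have hU : Uᴴ * U = 1 := Unitary.coe_star_mul_self _
  have hD : Uᴴ * E X * U = diagonal (fun i => (hH.eigenvalues i : ℂ)) := by
    have h := hH.conjStarAlgAut_star_eigenvectorUnitary
    rw [Unitary.conjStarAlgAut_star_apply] at h
    exact h
  have key : ∀ A : Matrix (Fin d) (Fin d) ℂ,
      (hH.cfc f * A).trace = ∑ i, (f (hH.eigenvalues i) : ℂ) * (Uᴴ * A * U) i i := by
    intro A
    rw [cfc_eq_conj_diagonal, ← hUdef, mul_assoc, mul_assoc, trace_mul_comm U]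
    simp only [mul_assoc, trace, diag, diagonal_mul]
  have heq := hE.trace_mul_apply X (cfc_mem_starSubalgebra N hH (hE.mem X) f)
  rw [key, key, hD] at heq
  have hre := congrArg Complex.re heq
  simp only [Complex.re_sum, Complex.re_ofReal_mul, diagonal_apply_eq, Complex.ofReal_re] at hre
  have hdiag : ∀ i, 0 < ((Uᴴ * X * U) i i).re := by
    have hpd : (Uᴴ * X * U).PosDef := hX.conjTranspose_mul_mul_same
      (Function.LeftInverse.injective (g := (Uᴴ *ᵥ ·)) fun v => by simp [hU])
    exact fun i => (Complex.lt_def.1 hpd.diag_pos).1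
  refine hre.not_lt (Finset.sum_lt_sum (fun i _ => ?_) ⟨i₀, Finset.mem_univ _, ?_⟩)
  · by_cases hi : hH.eigenvalues i ≤ 0
    · simpa [f, hi] using hi.trans (hdiag i).le
    · simp [f, hi]
  · simpa [f, hi₀] using hi₀.trans_lt (hdiag i₀)

theorem modularForm_le_apply (hE : IsHSProjection N E) {ρ τ : Matrix (Fin d) (Fin d) ℂ}
    (hρ : ρ.PosDef) (hτ : τ.PosDef) {t : ℝ} (ht : 0 ≤ t) (Y : Matrix (Fin d) (Fin d) ℂ) :
    modularForm (E ρ) (E τ) t Y ≤ modularForm ρ τ t (E Y) := by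
  have hmem := hE.mem Y
  have hmem' : (E Y)ᴴ ∈ N := star_mem hmem
  have heq : modularForm (E ρ) (E τ) t (E Y) = modularForm ρ τ t (E Y) := by
    have h (A : Matrix (Fin d) (Fin d) ℂ) :
        ((E Y)ᴴ * A * E Y).trace = (E Y * (E Y)ᴴ * A).trace := by
      rw [trace_mul_comm, mul_assoc]
    have h' (A : Matrix (Fin d) (Fin d) ℂ) :
        (E Y * A * (E Y)ᴴ).trace = ((E Y)ᴴ * E Y * A).trace := by
      rw [trace_mul_comm, mul_assoc]
    simp only [modularForm, h, h', hE.trace_mul_apply _ hmem',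
      hE.trace_mul_apply _ (mul_mem hmem hmem'), hE.trace_mul_apply _ (mul_mem hmem' hmem)]
  rw [← heq]
  nth_rewrite 1 [← add_sub_cancel (E Y) Y]
  refine modularForm_add_le (hE.apply_posDef hρ) (hE.apply_posDef hτ) ht ?_
  have hW : E ρ - (E τ * E Y + (t : ℂ) • (E Y * E ρ)) ∈ N :=
    sub_mem (hE.mem ρ) (add_mem (mul_mem (hE.mem τ) hmem)
      (SMulMemClass.smul_mem _ (mul_mem hmem (hE.mem ρ))))
  rw [← star_eq_zero, ← trace_conjTranspose, conjTranspose_mul, conjTranspose_conjTranspose]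
  exact hE.orthogonal Y _ hW

/-- Data processing inequality for a trace-preserving conditional expectation. -/
theorem relEnt_apply_le (hE : IsHSProjection N E) {ρ τ : Matrix (Fin d) (Fin d) ℂ}
    (hρ : ρ.PosDef) (hτ : τ.PosDef) : relEnt (E ρ) (E τ) ≤ relEnt ρ τ := by
  have htr : (E ρ).trace = ρ.trace := by simpa using hE.trace_mul_apply ρ (one_mem N)
  simpa using relEnt_le_sum_of_modularForm_le (Finset.univ : Finset Unit) (c := fun _ => 1)
    (by simp) (hE.apply_posDef hρ) (hE.apply_posDef hτ) (fun _ => hρ) (fun _ => hτ)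
    (by simp [htr]) (fun t ht Y => ⟨E Y, by simpa using hE.modularForm_le_apply hρ hτ ht Y⟩)

/-- Chain rule for the relative entropy along a trace-preserving conditional expectation. -/
theorem relEnt_apply_eq_add (hE : IsHSProjection N E) (ρ : Matrix (Fin d) (Fin d) ℂ)
    {σ : Matrix (Fin d) (Fin d) ℂ} (hρ : ρ.IsHermitian) (hσ : σ.IsHermitian) (hσN : σ ∈ N) :
    relEnt ρ σ = relEnt ρ (E ρ) + relEnt (E ρ) σ := by
  have hlog : ∀ A ∈ N, A.IsHermitian → (ρ * matLog A).trace = (E ρ * matLog A).trace := by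
    intro A hAN hA
    have hmem : matLog A ∈ N := by
      rw [matLog, dif_pos hA]
      exact cfc_mem_starSubalgebra N hA hAN _
    rw [trace_mul_comm, ← hE.trace_mul_apply ρ hmem, trace_mul_comm]
  simp only [relEnt, mul_sub, trace_sub, Complex.sub_re, hlog σ hσN hσ,
    hlog (E ρ) (hE.mem ρ) (hE.apply_isHermitian hρ)]
  ring

theorem relEnt_apply_le_add (hE : IsHSProjection N E) {ρ τ : Matrix (Fin d) (Fin d) ℂ}
    (hρ : ρ.PosDef) (hτ : τ.PosDef) : relEnt ρ (E τ) ≤ relEnt ρ (E ρ) + relEnt ρ τ := by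
  rw [hE.relEnt_apply_eq_add ρ hρ.1 (hE.apply_isHermitian hτ.1) (hE.mem τ)]
  exact add_le_add_right (hE.relEnt_apply_le hρ hτ) _

theorem relEnt_apply_nonneg (hE : IsHSProjection N E) {ρ : Matrix (Fin d) (Fin d) ℂ}
    (hρ : ρ.PosDef) : 0 ≤ relEnt ρ (E ρ) := by
  have h := hE.relEnt_apply_le_add hρ (hE.apply_posDef hρ)
  rw [hE.apply_eq_of_trace (hE.mem ρ) fun _ _ => rfl] at h
  linarith

end IsHSProjection

variable {J : ℕ} {Ns : Fin J → StarSubalgebra ℂ (Matrix (Fin d) (Fin d) ℂ)}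
  {Es : Fin J → (Matrix (Fin d) (Fin d) ℂ →ₗ[ℂ] Matrix (Fin d) (Fin d) ℂ)}
  {ρ : Matrix (Fin d) (Fin d) ℂ}

theorem compSeq_posDef (hE : ∀ j, IsHSProjection (Ns j) (Es j)) (hρ : ρ.PosDef)
    (s : List (Fin J)) : (compSeq Es s ρ).PosDef := by
  induction s with
  | nil => exact hρ
  | cons j s ih => exact (hE j).apply_posDef ih

theorem relEnt_compSeq_le (hE : ∀ j, IsHSProjection (Ns j) (Es j)) (hρ : ρ.PosDef)
    (s : List (Fin J)) :
    relEnt ρ (compSeq Es s ρ) ≤ ∑ j, (s.count j : ℝ) * relEnt ρ (Es j ρ) := by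
  induction s with
  | nil => simp [compSeq, relEnt]
  | cons i s ih =>
    have h : relEnt ρ (compSeq Es (i :: s) ρ)
        ≤ relEnt ρ (Es i ρ) + relEnt ρ (compSeq Es s ρ) :=
      (hE i).relEnt_apply_le_add hρ (compSeq_posDef hE hρ s)
    refine h.trans ?_
    simp only [List.count_cons, Nat.cast_add, add_mul, Finset.sum_add_distrib]
    simp only [beq_iff_eq, Nat.cast_ite, Nat.cast_one, Nat.cast_zero, ite_mul, one_mul, zero_mul,
      Finset.sum_ite_eq, Finset.mem_univ, if_true]
    linarith

end ConditionalExpectation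

section Convexity

variable {d : ℕ} {ι : Type*} {s : Finset ι} {c : ι → ℝ} {τs : ι → Matrix (Fin d) (Fin d) ℂ}

theorem sum_smul_posDef (hc : ∀ a ∈ s, 0 ≤ c a) (hc1 : ∑ a ∈ s, c a = 1)
    (hτs : ∀ a, (τs a).PosDef) : (∑ a ∈ s, c a • τs a).PosDef := by
  classical
  obtain ⟨a, ha, hpos⟩ : ∃ a ∈ s, 0 < c a := by
    by_contra! h
    linarith [Finset.sum_nonpos h]
  rw [← Finset.add_sum_erase s _ ha]
  exact ((hτs a).smul hpos).add_posSemidef (posSemidef_sum _ fun b hb =>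
    (hτs b).posSemidef.smul (hc b (Finset.mem_of_mem_erase hb)))

/-- Convexity of the relative entropy in its second argument. -/
theorem relEnt_sum_smul_le (hc : ∀ a ∈ s, 0 ≤ c a) (hc1 : ∑ a ∈ s, c a = 1)
    {ρ : Matrix (Fin d) (Fin d) ℂ} (hρ : ρ.PosDef) (hτs : ∀ a, (τs a).PosDef) :
    relEnt ρ (∑ a ∈ s, c a • τs a) ≤ ∑ a ∈ s, c a * relEnt ρ (τs a) := by
  refine relEnt_le_sum_of_modularForm_le s hc hρ (sum_smul_posDef hc hc1 hτs) (fun _ => hρ) hτs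
    (by rw [← Finset.sum_mul, hc1, one_mul]) fun t _ Y => ⟨Y, le_of_eq ?_⟩
  have h : (Yᴴ * (∑ a ∈ s, c a • τs a) * Y).trace.re
      = ∑ a ∈ s, c a * (Yᴴ * τs a * Y).trace.re := by
    simp only [Finset.mul_sum, Finset.sum_mul, trace_sum, Complex.re_sum, mul_smul_comm,
      smul_mul_assoc, trace_smul, Complex.smul_re, smul_eq_mul]
  simp only [modularForm, h, mul_sub, Finset.sum_sub_distrib, ← Finset.sum_mul, hc1, one_mul]

end Convexity

/-- **Lemma 3.3 (tracial case, finitely supported measure).**  Each `Es j` is the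
Hilbert–Schmidt orthogonal projection onto the unital *-subalgebra `Ns j`. -/
theorem relEnt_convex_chain_bound
    (d J : ℕ)
    (Ns : Fin J → StarSubalgebra ℂ (Matrix (Fin d) (Fin d) ℂ))
    (Es : Fin J → (Matrix (Fin d) (Fin d) ℂ →ₗ[ℂ] Matrix (Fin d) (Fin d) ℂ))
    (hEmem : ∀ (j : Fin J) (X : Matrix (Fin d) (Fin d) ℂ), Es j X ∈ Ns j)
    (hEfix : ∀ (j : Fin J), ∀ X ∈ Ns j, Es j X = X)
    (hEorth : ∀ (j : Fin J) (X : Matrix (Fin d) (Fin d) ℂ), ∀ Y ∈ Ns j,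
      (Yᴴ * (X - Es j X)).trace = 0)
    (S : Finset (List (Fin J))) (hS : ∀ s ∈ S, s ≠ [])
    (μ : List (Fin J) → ℝ)
    (hμ : ∀ s ∈ S, μ s ∈ Set.Icc (0:ℝ) 1) (hμ1 : ∑ s ∈ S, μ s = 1)
    (k : List (Fin J) → Fin J → ℕ)
    (hk : ∀ s ∈ S, ∀ j : Fin J, s.count j ≤ k s j)
    (ρ : Matrix (Fin d) (Fin d) ℂ) (hρ : ρ.PosDef) (hρtr : ρ.trace = 1) :
    ∑ s ∈ S, μ s * ∑ j : Fin J, (k s j : ℝ) * relEnt ρ (Es j ρ)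
      ≥ relEnt ρ (∑ s ∈ S, μ s • compSeq Es s ρ) := by
  have hE : ∀ j, IsHSProjection (Ns j) (Es j) := fun j => ⟨hEmem j, hEorth j⟩
  have hμ0 : ∀ s ∈ S, 0 ≤ μ s := fun s hs => (hμ s hs).1
  refine (relEnt_sum_smul_le hμ0 hμ1 hρ (compSeq_posDef hE hρ)).trans
    (Finset.sum_le_sum fun s hs => mul_le_mul_of_nonneg_left ?_ (hμ0 s hs))
  exact (relEnt_compSeq_le hE hρ s).trans (Finset.sum_le_sum fun j _ =>
    mul_le_mul_of_nonneg_right (Nat.cast_le.2 (hk s hs j)) ((hE j).relEnt_apply_nonneg hρ))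
end

section
/- For every natural number k ≥ 1: sqrt(1/(π·k)) · exp(−1/(6k)) < (2k choose k) · 4^{−k} < sqrt(1/(π·k)) · exp(1/(24k)). -/
open Filter Topology

/-- The Wallis product in terms of the central binomial coefficient. -/
theorem sq_centralBinom_div_four_pow_mul_wallis (k : ℕ) :
    ((Nat.centralBinom k : ℝ) / 4 ^ k) ^ 2 * ((2 * k + 1) * Real.Wallis.W k) = 1 := by
  have hc : (Nat.centralBinom k : ℝ) * (k.factorial : ℝ) ^ 2 = ((2 * k).factorial : ℝ) := by
    have h := Nat.choose_mul_factorial_mul_factorial (show k ≤ 2 * k by lia)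
    rw [show 2 * k - k = k by lia, ← Nat.centralBinom_eq_two_mul_choose] at h
    rw [← h]
    push_cast
    ring
  have hk : (k.factorial : ℝ) ≠ 0 := by positivity
  have hb : (Nat.centralBinom k : ℝ) ≠ 0 := by exact_mod_cast Nat.centralBinom_ne_zero k
  rw [Real.Wallis.W_eq_factorial_ratio, ← hc, pow_mul,
    show ((2 : ℝ) ^ 4) ^ k = (4 ^ k) ^ 2 by rw [pow_right_comm (4 : ℝ)]; norm_num]
  field_simp

/-- The sequence `(2k + 1) W k / (k + 1/3)` increases to `π`. -/
theorem wallis_mul_le_pi_mul_add_third (k : ℕ) :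
    (2 * k + 1) * Real.Wallis.W k ≤ Real.pi * (k + 1 / 3) := by
  have hmono : Monotone fun n : ℕ ↦ Real.Wallis.W n * ((2 * n + 1) / ((n : ℝ) + 1 / 3)) := by
    refine monotone_nat_of_le_succ fun n ↦ ?_
    rw [Real.Wallis.W_succ, mul_assoc]
    refine mul_le_mul_of_nonneg_left ?_ (Real.Wallis.W_pos n).le
    have hn : (0 : ℝ) ≤ n := n.cast_nonneg
    push_cast
    rw [div_mul_div_comm, div_mul_div_comm, div_le_div_iff₀ (by positivity) (by positivity)]
    have : 0 ≤ (n : ℝ) * (2 * n + 1) * (2 * n + 3) := by positivity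
    nlinarith
  have hlim : Tendsto (fun n : ℕ ↦ (2 * (n : ℝ) + 1) / ((n : ℝ) + 1 / 3)) atTop (𝓝 2) := by
    have h : Tendsto (fun n : ℕ ↦ 2 + (1 / 3 : ℝ) / ((n : ℝ) + 1 / 3)) atTop (𝓝 (2 + 0)) :=
      tendsto_const_nhds.add <| Tendsto.const_div_atTop
        (tendsto_atTop_add_const_right _ _ tendsto_natCast_atTop_atTop) _
    rw [add_zero] at h
    refine h.congr fun n ↦ ?_
    field_simp
    ring
  have hle := hmono.ge_of_tendsto (Real.Wallis.tendsto_W_nhds_pi_div_two.mul hlim) k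
  rw [div_mul_cancel₀ _ two_ne_zero, ← mul_div_assoc, div_le_iff₀ (by positivity)] at hle
  linarith

/-- **Equation (4.8).** Robbins's two-sided Stirling estimate for the central binomial
coefficient: `sqrt(1/(πk)) e^{-1/(6k)} < (2k choose k) 4^{-k} < sqrt(1/(πk)) e^{1/(24k)}`. -/
theorem centralBinom_robbins_bounds (k : ℕ) (hk : 1 ≤ k) :
    Real.sqrt (1 / (Real.pi * k)) * Real.exp (-1 / (6 * k))
        < (Nat.centralBinom k : ℝ) * (4 : ℝ) ^ (-(k : ℤ)) ∧
    (Nat.centralBinom k : ℝ) * (4 : ℝ) ^ (-(k : ℤ))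
        < Real.sqrt (1 / (Real.pi * k)) * Real.exp (1 / (24 * k)) := by
  have hk0 : (0 : ℝ) < k := by exact_mod_cast hk
  have hπ := Real.pi_pos
  have hW := Real.Wallis.W_pos k
  rw [zpow_neg, zpow_natCast, ← div_eq_mul_inv]
  set c : ℝ := (Nat.centralBinom k : ℝ) / 4 ^ k
  have hc : 0 ≤ c := by positivity
  have hcW : c ^ 2 = 1 / ((2 * k + 1) * Real.Wallis.W k) :=
    eq_one_div_of_mul_eq_one_left (sq_centralBinom_div_four_pow_mul_wallis k)
  constructor
  · refine lt_of_pow_lt_pow_left₀ 2 hc ?_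
    rw [mul_pow, Real.sq_sqrt (by positivity), ← Real.exp_nat_mul, hcW]
    calc 1 / (Real.pi * k) * Real.exp ((2 : ℕ) * (-1 / (6 * k)))
        = 1 / (Real.pi * k * Real.exp (1 / (3 * k))) := by
          rw [show ((2 : ℕ) : ℝ) * (-1 / (6 * k)) = -(1 / (3 * k)) by push_cast; ring,
            Real.exp_neg]
          field_simp
      _ < 1 / (Real.pi * (k + 1 / 3)) := by
          refine one_div_lt_one_div_of_lt (by positivity) ?_
          have hexp := Real.add_one_lt_exp (x := 1 / (3 * (k : ℝ))) (by positivity)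
          calc Real.pi * (k + 1 / 3) = Real.pi * k * (1 / (3 * k) + 1) := by field_simp; ring
            _ < _ := by gcongr
      _ ≤ 1 / ((2 * k + 1) * Real.Wallis.W k) :=
          one_div_le_one_div_of_le (by positivity) (wallis_mul_le_pi_mul_add_third k)
  · have hle : c ≤ Real.sqrt (1 / (Real.pi * k)) := by
      refine Real.le_sqrt_of_sq_le ?_
      rw [hcW]
      refine one_div_le_one_div_of_le (by positivity) ?_
      calc Real.pi * k ≤ (2 * k + 1) * ((2 * k + 1) / (2 * k + 2) * (Real.pi / 2)) := by
            field_simp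
            nlinarith
        _ ≤ _ := by
            gcongr
            exact Real.Wallis.le_W k
    refine hle.trans_lt (lt_mul_of_one_lt_right (by positivity) ?_)
    exact Real.one_lt_exp_iff.2 (by positivity)
end
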